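/- arXiv:1307.0453 — 2 statements merged into one kernel-verified Lean document; each statement's English description precedes it below -/
import Mathlib

section
/- For every integer n ≥ 1, the number of lists of length 2n over the two-element alphabet {0,1} that are palindromic, begin with 1, and in which every maximal run of consecutive equal letters has length at least 2, equals the Fibonacci number F_n (with F_1 = F_2 = 1); equivalently, if u_n denotes this count, then u_1 = u_2 = 1 and u_n = u_{n−1} + u_{n−2} for n ≥ 3. -/
/-- Every maximal run of consecutive equal entries of `l` has length at least 2:
`l` decomposes into blocks of repeated values, adjacent blocks having distinct
values (so each block is a maximal run), with every block of length at least 2. -/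
def RunsAtLeastTwo (l : List ℕ) : Prop :=
  ∃ blocks : List (ℕ × ℕ),
    l = (blocks.map fun p => List.replicate p.2 p.1).flatten ∧
    (∀ p ∈ blocks, 2 ≤ p.2) ∧
    blocks.Chain' fun p q => p.1 ≠ q.1

/-- Every entry of `l` equals one of its two neighbours, where `p` and `q` are the entries
(if any) placed just before and just after `l`. -/
def NoIsolated : Option ℕ → List ℕ → Option ℕ → Prop
  | _, [], _ => True
  | p, a :: t, q => (p = some a ∨ t.head?.or q = some a) ∧ NoIsolated (some a) t q

/-- Every entry of `l` except the last equals one of its two neighbours, where `p` is the entry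
(if any) placed just before `l`. -/
def NoIsolatedInit : Option ℕ → List ℕ → Prop
  | _, [] => True
  | _, [_] => True
  | p, a :: b :: t => (p = some a ∨ a = b) ∧ NoIsolatedInit (some a) (b :: t)

theorem noIsolated_concat (p q : Option ℕ) (t : List ℕ) (a : ℕ) :
    NoIsolated p (t ++ [a]) q ↔
      NoIsolated p t (some a) ∧ (t.getLast?.or p = some a ∨ q = some a) := by
  induction t generalizing p with
  | nil => simp [NoIsolated]
  | cons b t ih =>
    have h1 : (t ++ [a]).head?.or q = t.head?.or (some a) := by cases t <;> simp
    have h2 : (b :: t).getLast?.or p = t.getLast?.or (some b) := by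
      cases t <;> simp [List.getLast?_cons]
    simp only [List.cons_append, NoIsolated, ih, h1, h2]
    tauto

theorem noIsolated_append_reverse (p : Option ℕ) (w : List ℕ) :
    NoIsolated p (w ++ w.reverse) p ↔ NoIsolatedInit p w := by
  induction w generalizing p with
  | nil => simp [NoIsolated, NoIsolatedInit]
  | cons a w ih =>
    cases w with
    | nil => simp [NoIsolated, NoIsolatedInit]
    | cons b t =>
      have h : (a :: b :: t) ++ (a :: b :: t).reverse
          = a :: (((b :: t) ++ (b :: t).reverse) ++ [a]) := by simp
      rw [h, NoIsolated, noIsolated_concat, ih, NoIsolatedInit]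
      have h1 : ((b :: t) ++ (b :: t).reverse).getLast? = some b := by
        rw [List.getLast?_append]; simp
      rw [h1]
      simp only [List.cons_append, List.head?_cons, Option.some_or, Option.some.injEq]
      grind

theorem NoIsolated.replicate_append {a : ℕ} {l : List ℕ} {q : Option ℕ}
    (h : NoIsolated (some a) l q) (k : ℕ) :
    NoIsolated (some a) (List.replicate k a ++ l) q := by
  induction k with
  | zero => simpa using h
  | succ k ih => simpa [List.replicate_succ, NoIsolated] using ih

theorem noIsolated_flatten_replicate (blocks : List (ℕ × ℕ)) (h : ∀ p ∈ blocks, 2 ≤ p.2)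
    (p : Option ℕ) :
    NoIsolated p (blocks.map fun p => List.replicate p.2 p.1).flatten none := by
  induction blocks generalizing p with
  | nil => simp [NoIsolated]
  | cons x bs ih =>
    obtain ⟨a, k⟩ := x
    obtain ⟨j, rfl⟩ : ∃ j, k = j + 2 := Nat.exists_eq_add_of_le' (h (a, k) (by simp))
    have := (ih (fun p hp => h p (by simp [hp])) (some a)).replicate_append j
    simpa [List.replicate_succ, NoIsolated] using this

theorem RunsAtLeastTwo.exists_blocks {a : ℕ} {l : List ℕ} (h : RunsAtLeastTwo (a :: l)) :
    ∃ (k : ℕ) (bs : List (ℕ × ℕ)),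
      l = List.replicate (k + 1) a ++ (bs.map fun p => List.replicate p.2 p.1).flatten ∧
      (∀ p ∈ bs, 2 ≤ p.2) ∧
      ((a, k + 2) :: bs).IsChain fun p q => p.1 ≠ q.1 := by
  obtain ⟨blocks, hl, hb, hc⟩ := h
  cases blocks with
  | nil => simp at hl
  | cons x bs =>
    obtain ⟨b, k⟩ := x
    obtain ⟨j, rfl⟩ : ∃ j, k = j + 2 := Nat.exists_eq_add_of_le' (hb (b, k) (by simp))
    simp only [List.map_cons, List.flatten_cons, List.replicate_succ, List.cons_append,
      List.cons.injEq] at hl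
    obtain ⟨rfl, hl⟩ := hl
    exact ⟨j, bs, by simpa [List.replicate_succ] using hl,
      fun p hp => hb p (by simp [hp]), hc⟩

theorem RunsAtLeastTwo.cons_self {a : ℕ} {l : List ℕ} (h : RunsAtLeastTwo (a :: l)) :
    RunsAtLeastTwo (a :: a :: l) := by
  obtain ⟨k, bs, rfl, hb, hc⟩ := h.exists_blocks
  refine ⟨(a, k + 3) :: bs, by simp [List.replicate_succ], ?_, ?_⟩
  · simpa using hb
  · cases bs with
    | nil => exact List.isChain_singleton _
    | cons x bs => exact List.isChain_cons_cons.2 (List.isChain_cons_cons.1 hc)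

theorem RunsAtLeastTwo.cons_cons_of_ne {a b : ℕ} {l : List ℕ} (hab : a ≠ b)
    (h : RunsAtLeastTwo (b :: l)) : RunsAtLeastTwo (a :: a :: b :: l) := by
  obtain ⟨k, bs, rfl, hb, hc⟩ := h.exists_blocks
  refine ⟨(a, 2) :: (b, k + 2) :: bs, by simp [List.replicate_succ], ?_, ?_⟩
  · simpa using hb
  · exact List.isChain_cons_cons.2 ⟨hab, hc⟩

theorem NoIsolated.runsAtLeastTwo_cons_cons (a : ℕ) :
    ∀ l : List ℕ, NoIsolated (some a) l none → RunsAtLeastTwo (a :: a :: l)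
  | [], _ => ⟨[(a, 2)], by simp [List.replicate_succ], by simp, List.isChain_singleton _⟩
  | [b], h => by
    obtain rfl : a = b := by simpa [NoIsolated] using h
    exact (runsAtLeastTwo_cons_cons a [] trivial).cons_self
  | b :: c :: l, h => by
    by_cases hab : a = b
    · subst hab
      exact (runsAtLeastTwo_cons_cons a (c :: l) h.2).cons_self
    · obtain rfl : c = b := by simpa [NoIsolated, hab] using h.1
      exact (runsAtLeastTwo_cons_cons c l h.2.2).cons_cons_of_ne hab

theorem runsAtLeastTwo_iff_noIsolated (l : List ℕ) :
    RunsAtLeastTwo l ↔ NoIsolated none l none := by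
  constructor
  · rintro ⟨blocks, rfl, hb, -⟩
    exact noIsolated_flatten_replicate blocks hb none
  · intro h
    match l, h with
    | [], _ => exact ⟨[], by simp, by simp, List.isChain_nil⟩
    | [a], h => simp [NoIsolated] at h
    | a :: b :: l, h =>
      obtain rfl : b = a := by simpa [NoIsolated] using h.1
      exact h.2.2.runsAtLeastTwo_cons_cons

/-- The binary lists of length `n` that start with `a` and whose runs, except possibly the last
one, all have length at least 2. -/
def halfPalindromes : ℕ → ℕ → Finset (List ℕ)
  | 0, _ => ∅
  | 1, a => {[a]}
  | n + 2, a => (halfPalindromes (n + 1) a).image (List.cons a) ∪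
      (halfPalindromes n (1 - a)).image fun w => a :: a :: w

theorem mem_halfPalindromes (n a : ℕ) (ha : a ≤ 1) (w : List ℕ) :
    w ∈ halfPalindromes n a ↔ w.length = n ∧ (∀ d ∈ w, d = 0 ∨ d = 1) ∧
      w.head? = some a ∧ NoIsolatedInit none w := by
  induction n using Nat.twoStepInduction generalizing a w with
  | zero => cases w <;> simp [halfPalindromes]
  | one =>
    match w with
    | [] => simp [halfPalindromes]
    | [b] =>
      simp only [halfPalindromes, NoIsolatedInit, Finset.mem_singleton]
      grind
    | b :: c :: t => simp [halfPalindromes]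
  | more n ih0 ih1 =>
    simp only [halfPalindromes, Finset.mem_union, Finset.mem_image, ih1 a ha,
      ih0 (1 - a) (by omega)]
    constructor
    · rintro (⟨v, ⟨hl, hb, hh, hv⟩, rfl⟩ | ⟨v, ⟨hl, hb, hh, hv⟩, rfl⟩)
      · match v with
        | [b] => simp_all [NoIsolatedInit]
        | b :: c :: t => grind [NoIsolatedInit]
      · match v with
        | [b] => simp_all [NoIsolatedInit]; omega
        | b :: c :: t => grind [NoIsolatedInit]
    · rintro ⟨hl, hb, hh, hw⟩
      match w with
      | [b] => simp at hl
      | [b, c] => left; exact ⟨[c], by simp_all [NoIsolatedInit]⟩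
      | b :: c :: d :: t =>
        obtain rfl : b = a := by simpa using hh
        obtain rfl : b = c := by simpa [NoIsolatedInit] using hw.1
        by_cases hd : b = d
        · subst hd
          left
          refine ⟨b :: b :: t, ?_, rfl⟩
          cases t <;> simp_all [NoIsolatedInit]
        · right
          refine ⟨d :: t, ?_, rfl⟩
          have : d = 0 ∨ d = 1 := hb d (by simp)
          have : d = 1 - b := by omega
          cases t <;> grind [NoIsolatedInit]

theorem card_halfPalindromes (n a : ℕ) (ha : a ≤ 1) :
    (halfPalindromes n a).card = Nat.fib n := by
  induction n using Nat.twoStepInduction generalizing a with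
  | zero => simp [halfPalindromes]
  | one => simp [halfPalindromes]
  | more n ih0 ih1 =>
    rw [halfPalindromes, Finset.card_union_of_disjoint,
      Finset.card_image_of_injective _ List.cons_injective,
      Finset.card_image_of_injective _ (fun _ _ h => by simpa using h),
      ih0 _ (by omega), ih1 _ ha, Nat.fib_add_two, add_comm]
    rw [Finset.disjoint_left]
    intro w h1 h2
    simp only [Finset.mem_image, mem_halfPalindromes _ _ ha,
      mem_halfPalindromes _ (1 - a) (by omega)] at h1 h2
    obtain ⟨v, ⟨-, -, -, hv⟩, rfl⟩ := h1
    obtain ⟨u, ⟨-, -, hu, -⟩, h⟩ := h2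
    obtain rfl : a :: u = v := by simpa using h
    cases u with
    | nil => simp at hu
    | cons b t =>
      have h1 : a = b := by simpa [NoIsolatedInit] using hv.1
      have h2 : b = 1 - a := by simpa using hu
      omega

theorem List.eq_take_append_reverse_of_reverse_eq {α : Type*} {l : List α} {n : ℕ}
    (hl : l.length = 2 * n) (h : l.reverse = l) : l = l.take n ++ (l.take n).reverse := by
  have h1 : (l.take n).reverse = l.drop n := by
    rw [List.reverse_take, h, hl]
    congr 1
    omega
  rw [h1, List.take_append_drop]

theorem count_binary_palindromes_no_singleton_runs (n : ℕ) (hn : 1 ≤ n) :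
    {l : List ℕ | l.length = 2 * n ∧ (∀ d ∈ l, d = 0 ∨ d = 1) ∧
        l.head? = some 1 ∧ l.reverse = l ∧ RunsAtLeastTwo l}.ncard
      = Nat.fib n := by
  have hinj : Set.InjOn (fun w : List ℕ => w ++ w.reverse) (halfPalindromes n 1) := by
    intro v hv w hw h
    rw [Finset.mem_coe, mem_halfPalindromes _ _ le_rfl] at hv hw
    exact (List.append_inj h (hv.1.trans hw.1.symm)).1
  rw [← card_halfPalindromes n 1 le_rfl, ← Set.ncard_coe_finset, ← hinj.ncard_image]
  congr 1
  ext l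
  simp only [Set.mem_ofPred_eq, Set.mem_image, Finset.mem_coe, mem_halfPalindromes _ _ le_rfl,
    runsAtLeastTwo_iff_noIsolated]
  constructor
  · rintro ⟨hl, hb, hh, hr, h⟩
    have hsplit := List.eq_take_append_reverse_of_reverse_eq hl hr
    refine ⟨l.take n, ⟨by simp [hl]; omega, fun d hd => hb d (List.mem_of_mem_take hd), ?_, ?_⟩,
      hsplit.symm⟩
    · rw [List.head?_take, if_neg (by omega), hh]
    · rwa [hsplit, noIsolated_append_reverse] at h
  · rintro ⟨w, ⟨hl, hb, hh, h⟩, rfl⟩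
    refine ⟨by simp [hl]; omega, by simpa using hb, ?_, by simp,
      (noIsolated_append_reverse _ _).2 h⟩
    simp [hh]
end

section
/- A positive integer N is a (5,2)-reverse multiple if and only if N = 8·β, where β is a positive integer whose base-5 digit list is palindromic and contains only the digits 0 and 1. -/
/-- `N` is a `(g,k)`-reverse multiple: `N` is positive and reversing its base-`g`
digit list yields the base-`g` expansion of `k * N`. -/
def IsReverseMultiple (g k N : ℕ) : Prop :=
  0 < N ∧ Nat.ofDigits g (Nat.digits g N).reverse = k * N

theorem List.reverse_map_range {α : Type*} (f : ℕ → α) (n : ℕ) :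
    ((List.range n).map f).reverse = (List.range n).map (fun i => f (n - 1 - i)) := by
  apply List.ext_getElem <;> simp

theorem List.eq_map_range_getD {α : Type*} (L : List α) (d : α) :
    L = (List.range L.length).map (fun i => L.getD i d) := by
  apply List.ext_getElem
  · simp
  · intro i h _
    simp [h]

/-- The value of the list of digits `p * c (i + 1) + q * c i`, where `c` vanishes at both ends. -/
theorem Nat.ofDigits_map_range_add_shift (b p q : ℕ) (c : ℕ → ℕ) (m : ℕ) (h0 : c 0 = 0)
    (hm : c (m + 1) = 0) :
    Nat.ofDigits b ((List.range (m + 1)).map (fun i => p * c (i + 1) + q * c i)) =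
      (p + b * q) * Nat.ofDigits b ((List.range m).map (fun i => c (i + 1))) := by
  have hlin : ∀ l : List ℕ, Nat.ofDigits b (l.map (fun i => p * c (i + 1) + q * c i)) =
      p * Nat.ofDigits b (l.map (fun i => c (i + 1))) + q * Nat.ofDigits b (l.map c) := by
    intro l
    induction l with
    | nil => simp
    | cons x l ih =>
      simp only [List.map_cons, Nat.ofDigits_cons, ih]
      ring
  have hhigh : Nat.ofDigits b ((List.range (m + 1)).map (fun i => c (i + 1))) =
      Nat.ofDigits b ((List.range m).map (fun i => c (i + 1))) := by
    simp [List.range_succ, Nat.ofDigits_append, hm]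
  have hlow : Nat.ofDigits b ((List.range (m + 1)).map c) =
      b * Nat.ofDigits b ((List.range m).map (fun i => c (i + 1))) := by
    simp [List.range_succ_eq_map, Nat.ofDigits_cons, h0, Function.comp_def]
  rw [hlin, hhigh, hlow]
  ring

/-- The carries in the base-5 doubling of `L`, when the result `R` has the same length. -/
theorem exists_carries_of_two_mul_ofDigits (L : List ℕ) :
    ∀ (R : List ℕ) (c₀ : ℕ), c₀ ≤ 1 → L.length = R.length → (∀ x ∈ L, x < 5) →
      (∀ x ∈ R, x < 5) → 2 * Nat.ofDigits 5 L + c₀ = Nat.ofDigits 5 R →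
      ∃ c : ℕ → ℕ, c 0 = c₀ ∧ c L.length = 0 ∧ (∀ i ≤ L.length, c i ≤ 1) ∧
        ∀ i < L.length, 2 * L.getD i 0 + c i = R.getD i 0 + 5 * c (i + 1) := by
  induction L with
  | nil =>
    intro R c₀ _ hlen _ _ h
    obtain rfl : R = [] := List.length_eq_zero_iff.mp hlen.symm
    obtain rfl : c₀ = 0 := by simpa using h
    exact ⟨fun _ => 0, by simp⟩
  | cons x X ih =>
    intro R c₀ hc₀ hlen hL hR h
    cases R with
    | nil => simp at hlen
    | cons y Y =>
      simp only [List.mem_cons, forall_eq_or_imp] at hL hR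
      simp only [Nat.ofDigits_cons] at h
      obtain ⟨hx, hX⟩ := hL
      obtain ⟨hy, hY⟩ := hR
      obtain ⟨c, hc0, hcn, hc1, hc⟩ := ih Y ((2 * x + c₀) / 5) (by omega)
        (by simpa using hlen) hX hY (by omega)
      refine ⟨fun i => Nat.casesOn i c₀ c, rfl, hcn, ?_, ?_⟩
      · rintro (_ | i) hi
        · exact hc₀
        · exact hc1 i (by simpa using hi)
      · rintro (_ | i) hi
        · change 2 * x + c₀ = y + 5 * c 0
          rw [hc0]
          omega
        · simpa using hc i (by simpa using hi)

theorem IsReverseMultiple.exists_palindromic_factor {N : ℕ} (h : IsReverseMultiple 5 2 N) :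
    ∃ β : ℕ, 0 < β ∧ N = 8 * β ∧ (Nat.digits 5 β).reverse = Nat.digits 5 β ∧
      ∀ d ∈ Nat.digits 5 β, d = 0 ∨ d = 1 := by
  obtain ⟨hN, hrev⟩ := h
  have hlt : ∀ x ∈ Nat.digits 5 N, x < 5 := fun x hx => Nat.digits_lt_base (by norm_num) hx
  have hne : Nat.digits 5 N ≠ [] := Nat.digits_ne_nil_iff_ne_zero.mpr hN.ne'
  have hlast : ∀ h, (Nat.digits 5 N).getLast h ≠ 0 :=
    fun _ => Nat.getLast_digit_ne_zero 5 hN.ne'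
  have hval := Nat.ofDigits_digits 5 N
  obtain ⟨c, hc0, hcn, hc1, hc⟩ := exists_carries_of_two_mul_ofDigits (Nat.digits 5 N)
    (Nat.digits 5 N).reverse 0 (by norm_num) (by simp) hlt (by simpa using hlt)
    (by rw [hval, hrev]; simp)
  obtain ⟨m, hm⟩ : ∃ m, (Nat.digits 5 N).length = m + 1 :=
    Nat.exists_eq_succ_of_ne_zero (List.length_pos_iff.mpr hne).ne'
  generalize Nat.digits 5 N = L at *
  rw [hm] at hcn hc1 hc
  have hc' : ∀ i ≤ m, 2 * L.getD i 0 + c i = L.getD (m - i) 0 + 5 * c (i + 1) := by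
    intro i hi
    rw [hc i (by omega)]
    have : i < L.length := by omega
    simp [List.getElem?_reverse this, hm]
  have hstep : ∀ i ≤ m, c i = c (m + 1 - i) →
      c (i + 1) = c (m - i) ∧ L.getD i 0 = 3 * c (i + 1) + 1 * c i := by
    intro i hi hsymm
    have e1 := hc' i hi
    have e2 := hc' (m - i) (by omega)
    rw [show m - (m - i) = i by omega, show m - i + 1 = m + 1 - i by omega] at e2
    have b1 := hc1 i (by omega)
    have b2 := hc1 (i + 1) (by omega)
    have b3 := hc1 (m - i) (by omega)
    omega
  have hsymm : ∀ i ≤ m + 1, c i = c (m + 1 - i) := by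
    intro i
    induction i with
    | zero => simp [hc0, hcn]
    | succ i ih =>
      intro hi
      rw [(hstep i (by omega) (ih (by omega))).1]
      congr 1
      omega
  have hdig : ∀ i ≤ m, L.getD i 0 = 3 * c (i + 1) + 1 * c i :=
    fun i hi => (hstep i hi (hsymm i (by omega))).2
  have hLmap : L = (List.range (m + 1)).map (fun i => 3 * c (i + 1) + 1 * c i) := by
    conv_lhs => rw [List.eq_map_range_getD L 0, hm]
    exact List.map_congr_left fun i hi => hdig i (by simp at hi; omega)
  have hcm : c m ≠ 0 := by
    have := hdig m le_rfl
    replace hlast := hlast hne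
    rw [List.getLast_eq_getElem] at hlast
    simp [hm, hcn] at this hlast
    rwa [← this]
  set B := (List.range m).map (fun i => c (i + 1)) with hB
  have hB01 : ∀ d ∈ B, d = 0 ∨ d = 1 := by
    intro d hd
    obtain ⟨i, hi, rfl⟩ := List.mem_map.mp hd
    have := hc1 (i + 1) (by simp at hi; omega)
    omega
  have hNB : N = 8 * Nat.ofDigits 5 B := by
    rw [← hval, hLmap, Nat.ofDigits_map_range_add_shift 5 3 1 c m hc0 hcn]
  have hdB : Nat.digits 5 (Nat.ofDigits 5 B) = B := by
    refine Nat.digits_ofDigits 5 (by norm_num) B ?_ ?_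
    · intro d hd
      rcases hB01 d hd with rfl | rfl <;> norm_num
    · intro hBne
      have hm0 : m ≠ 0 := by
        rintro rfl
        simp [hB] at hBne
      rw [List.getLast_eq_getElem]
      simpa [hB, Nat.sub_add_cancel (Nat.one_le_iff_ne_zero.mpr hm0)] using hcm
  refine ⟨Nat.ofDigits 5 B, by omega, hNB, ?_, by rwa [hdB]⟩
  rw [hdB, hB, List.reverse_map_range]
  refine List.map_congr_left fun i hi => ?_
  have hi : i < m := by simpa using hi
  rw [hsymm (i + 1) (by omega)]
  congr 1
  omega

theorem isReverseMultiple_eight_mul {β : ℕ} (hβ : 0 < β)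
    (hpal : (Nat.digits 5 β).reverse = Nat.digits 5 β)
    (h01 : ∀ d ∈ Nat.digits 5 β, d = 0 ∨ d = 1) : IsReverseMultiple 5 2 (8 * β) := by
  refine ⟨by omega, ?_⟩
  have hval := Nat.ofDigits_digits 5 β
  have hne : Nat.digits 5 β ≠ [] := Nat.digits_ne_nil_iff_ne_zero.mpr hβ.ne'
  have hlast : ∀ h, (Nat.digits 5 β).getLast h ≠ 0 :=
    fun _ => Nat.getLast_digit_ne_zero 5 hβ.ne'
  generalize Nat.digits 5 β = B at *
  obtain ⟨m, hm⟩ : ∃ m, B.length = m := ⟨_, rfl⟩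
  have hm0 : 0 < m := hm ▸ List.length_pos_iff.mpr hne
  obtain ⟨c, hc0, hc⟩ : ∃ c : ℕ → ℕ, c 0 = 0 ∧ ∀ i, c (i + 1) = B.getD i 0 :=
    ⟨fun i => Nat.casesOn i 0 (fun j => B.getD j 0), rfl, fun _ => rfl⟩
  have hcn : c (m + 1) = 0 := by simp [hc, hm]
  have hBmap : B = (List.range m).map (fun i => c (i + 1)) := by
    simp only [hc]
    rw [← hm]
    exact List.eq_map_range_getD B 0
  have hc1 : ∀ i, c i ≤ 1 := by
    rintro (_ | i)
    · omega
    · rw [hc]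
      by_cases hi : i < B.length
      · have := h01 B[i] (List.getElem_mem hi)
        simp [hi]
        omega
      · simp [not_lt.mp hi]
  have hcm : c m ≠ 0 := by
    obtain ⟨k, rfl⟩ := Nat.exists_eq_succ_of_ne_zero hm0.ne'
    replace hlast := hlast hne
    rw [List.getLast_eq_getElem] at hlast
    simpa [hc, hm] using hlast
  have hsymm : ∀ i ≤ m + 1, c (m + 1 - i) = c i := by
    rintro (_ | i) hi
    · simp [hc0, hcn]
    · rcases Nat.lt_or_ge i m with him | him
      · rw [show m + 1 - (i + 1) = (m - 1 - i) + 1 by omega, hc, hc]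
        conv_rhs => rw [← hpal]
        have h1 : i < B.length := by omega
        simp [List.getElem?_reverse h1, hm]
      · obtain rfl : i = m := by omega
        simp [hc0, hcn]
  have hdig : Nat.digits 5 (8 * β) =
      (List.range (m + 1)).map (fun i => 3 * c (i + 1) + 1 * c i) := by
    rw [← hval, hBmap, show 8 = 3 + 5 * 1 from rfl,
      ← Nat.ofDigits_map_range_add_shift 5 3 1 c m hc0 hcn]
    refine Nat.digits_ofDigits 5 (by norm_num) _ ?_ ?_
    · intro d hd
      obtain ⟨i, _, rfl⟩ := List.mem_map.mp hd
      have := hc1 i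
      have := hc1 (i + 1)
      omega
    · intro _
      rw [List.getLast_eq_getElem]
      simp [hcn, hcm]
  have hrev : (Nat.digits 5 (8 * β)).reverse =
      (List.range (m + 1)).map (fun i => 1 * c (i + 1) + 3 * c i) := by
    rw [hdig, List.reverse_map_range]
    refine List.map_congr_left fun i hi => ?_
    have hi : i < m + 1 := by simpa using hi
    rw [← hsymm i (by omega), ← hsymm (i + 1) (by omega),
      show m + 1 - 1 - i + 1 = m + 1 - i by omega,
      show m + 1 - 1 - i = m + 1 - (i + 1) by omega]
    ring
  rw [hrev, Nat.ofDigits_map_range_add_shift 5 1 3 c m hc0 hcn, ← hBmap, hval]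
  ring

theorem reverse_multiple_5_2_iff (N : ℕ) (hN : 0 < N) :
    IsReverseMultiple 5 2 N ↔
      ∃ β : ℕ, 0 < β ∧ N = 8 * β ∧
        (Nat.digits 5 β).reverse = Nat.digits 5 β ∧
        (∀ d ∈ Nat.digits 5 β, d = 0 ∨ d = 1) := by
  constructor
  · exact IsReverseMultiple.exists_palindromic_factor
  · rintro ⟨β, hβ, rfl, hpal, h01⟩
    exact isReverseMultiple_eight_mul hβ hpal h01
end
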